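/- Let m, n ≥ 3. The maximal real subfield k_m is contained in k_n if and only if m ∈ {3, 4, 6}, or m divides n, or m = 2d where d is an odd divisor of n. -/

import Mathlib

/-- `ζ_n = e^{2πi/n}`, a primitive `n`-th root of unity in `ℂ`. -/
noncomputable def zeta (n : ℕ) : ℂ := Complex.exp (2 * Real.pi * Complex.I / n)

/-- The maximal real subfield `k_n = ℚ(ζ_n + ζ_n⁻¹)` of the `n`-th cyclotomic field. -/
noncomputable def realCyclField (n : ℕ) : IntermediateField ℚ ℂ :=
  IntermediateField.adjoin ℚ {zeta n + (zeta n)⁻¹}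

theorem zeta_prim (n : ℕ) (hn : n ≠ 0) : IsPrimitiveRoot (zeta n) n :=
  Complex.isPrimitiveRoot_exp n hn

theorem zeta_ne (n : ℕ) : zeta n ≠ 0 := Complex.exp_ne_zero _

theorem pow_add_mem (K : IntermediateField ℚ ℂ) (z : ℂ) (hz : z ≠ 0) (h : z + z⁻¹ ∈ K) (k : ℕ) :
    z ^ k + (z ^ k)⁻¹ ∈ K ∧ z ^ (k + 1) + (z ^ (k + 1))⁻¹ ∈ K := by
  induction k with
  | zero =>
    refine ⟨?_, by simpa using h⟩
    simpa using K.add_mem K.one_mem K.one_mem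
  | succ k ih =>
    refine ⟨ih.2, ?_⟩
    have e : z ^ (k + 1 + 1) + (z ^ (k + 1 + 1))⁻¹ =
        (z + z⁻¹) * (z ^ (k + 1) + (z ^ (k + 1))⁻¹) - (z ^ k + (z ^ k)⁻¹) := by
      field_simp
      ring
    rw [e]
    exact K.sub_mem (K.mul_mem h ih.2) ih.1

theorem zeta_mul_pow (d k : ℕ) (hd : d ≠ 0) (hk : k ≠ 0) : zeta (d * k) ^ k = zeta d := by
  unfold zeta
  rw [← Complex.exp_nat_mul]
  congr 1
  have : (d : ℂ) ≠ 0 := by exact_mod_cast hd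
  have : (k : ℂ) ≠ 0 := by exact_mod_cast hk
  push_cast
  field_simp

theorem mem_of_dvd (d n k : ℕ) (hn : n ≠ 0) (h : d ∣ n) :
    zeta d ^ k + (zeta d ^ k)⁻¹ ∈ realCyclField n := by
  obtain ⟨c, rfl⟩ := h
  rw [← zeta_mul_pow d c (by rintro rfl; simp at hn) (by rintro rfl; simp at hn), ← pow_mul]
  exact (pow_add_mem _ _ (zeta_ne _) (IntermediateField.mem_adjoin_simple_self ℚ _) _).1

theorem le_of_mem (m : ℕ) (K : IntermediateField ℚ ℂ) (h : zeta m + (zeta m)⁻¹ ∈ K) :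
    realCyclField m ≤ K := by
  unfold realCyclField
  rw [IntermediateField.adjoin_le_iff]
  simpa using h

theorem zeta_two_mul (k : ℕ) : zeta (2 * (2 * k + 1)) = - zeta (2 * k + 1) ^ (k + 1) := by
  unfold zeta
  rw [← Complex.exp_nat_mul, ← neg_one_mul, ← Complex.exp_pi_mul_I, ← Complex.exp_add,
    Complex.exp_eq_exp_iff_exists_int]
  refine ⟨-1, ?_⟩
  have : (2 * k + 1 : ℂ) ≠ 0 := by exact_mod_cast (by omega : 2 * k + 1 ≠ 0)
  push_cast
  field_simp
  ring

theorem mem_bot (m : ℕ) (hm : m = 3 ∨ m = 4 ∨ m = 6) (K : IntermediateField ℚ ℂ) :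
    zeta m + (zeta m)⁻¹ ∈ K := by
  have h3 : zeta 3 + (zeta 3)⁻¹ = -1 := by
    have h := (zeta_prim 3 (by norm_num)).geom_sum_eq_zero (by norm_num)
    simp only [Finset.sum_range_succ, Finset.sum_range_zero] at h
    have := zeta_ne 3
    field_simp
    linear_combination h
  rcases hm with rfl | rfl | rfl
  · rw [h3]; exact K.neg_mem K.one_mem
  · have h1 := (zeta_prim 4 (by norm_num)).pow_eq_one
    have h2 := (zeta_prim 4 (by norm_num)).pow_ne_one_of_pos_of_lt (l := 2) (by norm_num)
      (by norm_num)
    have h0 := zeta_ne 4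
    have h5 : (zeta 4 ^ 2 - 1) * (zeta 4 ^ 2 + 1) = 0 := by linear_combination h1
    have h6 := (mul_eq_zero.1 h5).resolve_left (sub_ne_zero.2 h2)
    have : zeta 4 + (zeta 4)⁻¹ = 0 := by
      field_simp
      linear_combination h6
    rw [this]; exact K.zero_mem
  · have h := zeta_two_mul 1
    norm_num at h
    have h1 := (zeta_prim 3 (by norm_num)).pow_eq_one
    have h0 := zeta_ne 3
    have e : zeta 6 + (zeta 6)⁻¹ = 1 := by
      have h7 : (zeta 6)⁻¹ = - zeta 3 := by
        rw [h, inv_eq_iff_eq_inv]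
        field_simp
        linear_combination -h1
      rw [h7, h]
      have h8 : zeta 3 ^ 2 = (zeta 3)⁻¹ := by
        field_simp
        linear_combination h1
      rw [h8]
      linear_combination -h3
    rw [e]; exact K.one_mem

theorem add_inv_eq {x y : ℂ} (hx : x ≠ 0) (hy : y ≠ 0) (h : x + x⁻¹ = y + y⁻¹) :
    x = y ∨ x * y = 1 := by
  have : (x - y) * (x * y - 1) = 0 := by
    field_simp at h
    linear_combination h
  rcases mul_eq_zero.1 this with h | h
  · left; linear_combination h
  · right; linear_combination h

theorem galois_step (m n : ℕ) (hm : 3 ≤ m) (hn : 3 ≤ n)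
    (h : realCyclField m ≤ realCyclField n) (a : ℕ) (ham : a.Coprime m)
    (han : a ≡ 1 [MOD n]) : a ≡ 1 [MOD m] ∨ m ∣ a + 1 := by
  have hN : m * n ≠ 0 := by positivity
  set z := zeta (m * n) with hz
  have hzp : IsPrimitiveRoot z (m * n) := zeta_prim _ hN
  have haN : a.Coprime (m * n) := by
    apply Nat.Coprime.mul_right ham
    have := han.gcd_eq
    simpa using this
  have hint : IsIntegral ℚ z := (hzp.isIntegral (by positivity)).tower_top
  have hmp : minpoly ℚ z = minpoly ℚ (z ^ a) := by
    rw [← Polynomial.cyclotomic_eq_minpoly_rat hzp (by positivity),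
      ← Polynomial.cyclotomic_eq_minpoly_rat (hzp.pow_of_coprime a haN) (by positivity)]
  let f : IntermediateField.adjoin ℚ {z} →ₐ[ℚ] ℂ :=
    (IntermediateField.algHomAdjoinIntegralEquiv ℚ hint).symm ⟨z ^ a, by
      rw [Polynomial.mem_aroots, hmp]
      exact ⟨hmp ▸ minpoly.ne_zero hint, minpoly.aeval _ _⟩⟩
  have hf : f (IntermediateField.AdjoinSimple.gen ℚ z) = z ^ a :=
    IntermediateField.algHomAdjoinIntegralEquiv_symm_apply_gen ℚ hint _
  let E : IntermediateField ℚ (IntermediateField.adjoin ℚ {z}) :=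
    { AlgHom.equalizer f (IntermediateField.val _) with
      inv_mem' := by
        intro x hx
        simp only [AlgHom.equalizer] at hx ⊢
        change f x = _ at hx
        change f x⁻¹ = _
        rw [map_inv₀, hx]
        rfl }
  have hE : ∀ x, x ∈ E ↔ f x = (x : ℂ) := fun x => Iff.rfl
  set g := IntermediateField.AdjoinSimple.gen ℚ z with hg
  have hgz : (g : ℂ) = z := IntermediateField.AdjoinSimple.coe_gen ℚ z
  have hzm : z ^ n = zeta m := zeta_mul_pow m n (by omega) (by omega)
  have hzn : z ^ m = zeta n := by
    rw [hz, mul_comm]; exact zeta_mul_pow n m (by omega) (by omega)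
  have hle : realCyclField n ≤ E.map (IntermediateField.val _) := by
    apply le_of_mem
    refine ⟨g ^ m + (g ^ m)⁻¹, ?_, ?_⟩
    · change _ ∈ E
      rw [hE]
      simp only [map_add, map_inv₀, map_pow, hf]
      push_cast
      rw [hgz, ← pow_mul, mul_comm a m, pow_mul, hzn]
      have : zeta n ^ a = zeta n := by
        have := (zeta_prim n (by omega)).eq_orderOf
        conv_rhs => rw [← pow_one (zeta n)]
        rw [((zeta_prim n (by omega)).isOfFinOrder (by omega)).pow_eq_pow_iff_modEq, ← this]
        exact han
      rw [this]
    · change ((g ^ m + (g ^ m)⁻¹ : IntermediateField.adjoin ℚ {z}) : ℂ) = _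
      push_cast
      rw [hgz, hzn]
  have hmem := hle (h (IntermediateField.mem_adjoin_simple_self ℚ _))
  obtain ⟨y, hy, hy2⟩ := hmem
  change y ∈ E at hy
  rw [hE] at hy
  have hy3 : y = g ^ n + (g ^ n)⁻¹ := by
    apply Subtype.ext
    change (y : ℂ) = _ at hy2
    rw [hy2]
    push_cast
    rw [hgz, hzm]
  rw [hy3] at hy
  simp only [map_add, map_inv₀, map_pow, hf] at hy
  push_cast at hy
  rw [hgz, ← pow_mul, mul_comm a n, pow_mul, hzm] at hy
  have ho := (zeta_prim m (by omega)).eq_orderOf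
  rcases add_inv_eq (pow_ne_zero _ (zeta_ne m)) (zeta_ne m) hy with h1 | h1
  · left
    conv_rhs at h1 => rw [← pow_one (zeta m)]
    rw [((zeta_prim m (by omega)).isOfFinOrder (by omega)).pow_eq_pow_iff_modEq, ← ho] at h1
    exact h1
  · right
    rw [← pow_succ] at h1
    exact (zeta_prim m (by omega)).dvd_of_pow_eq_one _ h1

theorem realCyclField_le_iff_div (m n : ℕ) (hm : 3 ≤ m) (hn : 3 ≤ n) :
    realCyclField m ≤ realCyclField n ↔
      (m ∈ ({3, 4, 6} : Set ℕ) ∨ m ∣ n ∨ ∃ d : ℕ, Odd d ∧ d ∣ n ∧ m = 2 * d) := by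
  constructor
  · intro h
    have H : ∀ b : ℕ, b.Coprime m → b ≡ 1 [MOD m.gcd n] → b ≡ 1 [MOD m] ∨ m ∣ b + 1 := by
      intro b hb hb1
      obtain ⟨a, ha1, ha2⟩ := Nat.chineseRemainder' hb1
      have ham : a.Coprime m := by
        have := ha1.gcd_eq
        unfold Nat.Coprime at *
        omega
      rcases galois_step m n hm hn h a ham ha2 with h1 | h1
      · exact Or.inl (ha1.symm.trans h1)
      · exact Or.inr (((ha1.add_right 1).dvd_iff dvd_rfl).1 h1)
    have hgm := Nat.gcd_dvd_left m n
    have hgn := Nat.gcd_dvd_right m n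
    set g := m.gcd n with hg
    have hgpos : 0 < g := Nat.gcd_pos_of_pos_left _ (by omega)
    by_cases hg2 : g ≤ 2
    · left
      have H' : ∀ b : ℕ, b.Coprime m → 1 < b → b < m → b + 1 = m := by
        intro b hb hb1 hbm
        have hbg : b ≡ 1 [MOD g] := by
          have : g = 1 ∨ g = 2 := by omega
          rcases this with h1 | h1
          · rw [h1]; exact Nat.modEq_one
          · rw [h1] at hgm ⊢
            have : b.Coprime 2 := hb.coprime_dvd_right hgm
            exact Nat.odd_iff.1 (Nat.coprime_two_right.1 this)
        rcases H b hb hbg with h1 | h1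
        · exfalso
          have := Nat.ModEq.eq_of_lt_of_lt h1 hbm (by omega)
          omega
        · have := Nat.le_of_dvd (by omega) h1
          omega
      simp only [Set.mem_insert_iff, Set.mem_singleton_iff]
      have hmod : m % 2 = 1 ∨ m % 4 = 0 ∨ m % 4 = 2 := by omega
      rcases hmod with h1 | h1 | h1
      · have := H' 2 (Nat.coprime_two_left.2 (Nat.odd_iff.2 h1)) (by omega) (by omega)
        omega
      · obtain ⟨k, rfl⟩ : ∃ k, m = 4 * k := ⟨m / 4, by omega⟩
        have hc : (2 * k + 1).Coprime (4 * k) := by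
          have h2 : (2 * k + 1).Coprime (2 * (2 * k)) := by
            apply Nat.Coprime.mul_right
            · exact Nat.coprime_two_right.2 ⟨k, rfl⟩
            · simp
          rwa [show 4 * k = 2 * (2 * k) by ring]
        have := H' _ hc (by omega) (by omega)
        omega
      · obtain ⟨k, rfl⟩ : ∃ k, m = 2 * (2 * k + 1) := ⟨m / 4, by omega⟩
        have hc : (2 * k + 3).Coprime (2 * (2 * k + 1)) := by
          apply Nat.Coprime.mul_right
          · exact Nat.coprime_two_right.2 ⟨k + 1, by ring⟩
          · rw [show 2 * k + 3 = 2 + (2 * k + 1) by ring, Nat.coprime_add_self_left]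
            exact Nat.coprime_two_left.2 ⟨k, rfl⟩
        have := H' _ hc (by omega) (by omega)
        omega
    · right
      have : NeZero m := ⟨by omega⟩
      have : NeZero g := ⟨by omega⟩
      have hinj : Function.Injective (ZMod.unitsMap hgm) := by
        rw [injective_iff_map_eq_one]
        intro u hu
        have hb : (u : ZMod m).val.Coprime m := ZMod.val_coe_unit_coprime u
        have hb1 : (u : ZMod m).val ≡ 1 [MOD g] := by
          rw [← ZMod.natCast_eq_natCast_iff]
          have := congrArg Units.val hu
          rw [ZMod.unitsMap_val] at this
          rw [ZMod.natCast_val, this]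
          simp
        rcases H _ hb hb1 with h1 | h1
        · rw [← ZMod.natCast_eq_natCast_iff] at h1
          apply Units.ext
          simpa using h1
        · exfalso
          have h2 : g ∣ (u : ZMod m).val + 1 := hgm.trans h1
          have h3 := ((hb1.add_right 1).dvd_iff dvd_rfl).1 h2
          have := Nat.le_of_dvd (by omega) h3
          omega
      have hcard := Fintype.card_le_of_injective _ hinj
      rw [ZMod.card_units_eq_totient, ZMod.card_units_eq_totient] at hcard
      have hle : g.totient ≤ m.totient :=
        Nat.le_of_dvd (Nat.totient_pos.2 (by omega)) (Nat.totient_dvd_of_dvd hgm)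
      have heq := le_antisymm hle hcard
      rcases Nat.eq_or_eq_of_totient_eq_totient hgm heq with h1 | h1
      · left; rw [← h1]; exact hgn
      · right
        refine ⟨g, ?_, hgn, h1.symm⟩
        by_contra hodd
        rw [Nat.not_odd_iff_even] at hodd
        have := Nat.totient_two_mul_of_even hodd
        rw [h1] at this
        have := Nat.totient_pos.2 hgpos
        omega
  · rintro (h | h | ⟨d, ⟨k, rfl⟩, hd, rfl⟩)
    · exact le_of_mem _ _ (mem_bot m (by simpa using h) _)
    · apply le_of_mem
      simpa using mem_of_dvd m n 1 (by omega) h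
    · apply le_of_mem
      rw [zeta_two_mul, inv_neg, ← neg_add]
      exact IntermediateField.neg_mem _ (mem_of_dvd _ n _ (by omega) hd)
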